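/- Let G be a discrete group and L a proper length function on G. Suppose t > s > 3r > 0, and suppose f : G → ℂ is finitely supported and vanishes identically on both annuli A(s−2r, s) and A(t, t+2r). Then ‖λ_{f·χ_{A(s,t)}}‖ ≤ r⁻¹ · (|B(t+r)|/|B(r)|)^{1/2} · J_D(f) and J_D(f·χ_{A(s,t)}) ≤ (|B(t+r)|/|B(r)|)^{1/2} · J_D(f), where f·χ_{A(s,t)} denotes the pointwise product. -/

import Mathlib

open scoped ENNReal ComplexConjugate

noncomputable section

variable {G : Type*}

/-- The Hilbert space `ℓ²(G)` of square-summable complex-valued functions on `G`. -/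
abbrev l2 (G : Type*) : Type _ := lp (fun _ : G => ℂ) 2

variable [Group G]

/-- A length function on a group `G`: subadditive, symmetric under inverses,
and vanishing exactly at the identity. -/
structure IsLengthFunction (L : G → ℝ) : Prop where
  nonneg : ∀ x, 0 ≤ L x
  subadd : ∀ x y, L (x * y) ≤ L x + L y
  inv_eq : ∀ x, L x⁻¹ = L x
  eq_zero_iff : ∀ x, L x = 0 ↔ x = 1

/-- The ball `B(r) = {x ∈ G : L x ≤ r}`. -/
def lball (L : G → ℝ) (r : ℝ) : Set G := {x : G | L x ≤ r}

/-- A length function is proper if all balls are finite. -/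
def IsProperLF (L : G → ℝ) : Prop := ∀ r : ℝ, (lball L r).Finite

/-- Bounded doubling: `L` is proper and there is `C < ∞` with
`|B(2r)| ≤ C |B(r)|` for all `r ≥ 1`. -/
def HasBoundedDoubling (L : G → ℝ) : Prop :=
  IsProperLF L ∧ ∃ C : ℝ, ∀ r : ℝ, 1 ≤ r →
    ((lball L (2 * r)).ncard : ℝ) ≤ C * ((lball L r).ncard : ℝ)

/-- `T` is the convolution operator `λ_f`, `(λ_f ξ)(x) = Σ_y f(xy⁻¹) ξ(y)`. -/
def IsConvOp (f : G → ℂ) (T : l2 G →L[ℂ] l2 G) : Prop :=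
  ∀ (ξ : l2 G) (x : G), T ξ x = ∑' y : G, f (x * y⁻¹) * ξ y

/-- `T` is the commutator `[D, λ_f]` for `D = M_L`, i.e.
`([D,λ_f] ξ)(x) = Σ_y (L x − L y) f(xy⁻¹) ξ(y)`. -/
def IsCommOp (L : G → ℝ) (f : G → ℂ) (T : l2 G →L[ℂ] l2 G) : Prop :=
  ∀ (ξ : l2 G) (x : G), T ξ x = ∑' y : G, ((L x : ℂ) - (L y : ℂ)) * f (x * y⁻¹) * ξ y

/-- `T` is the truncated operator `(I − M_{2r}) λ_f M_r`. -/
def IsTruncOp (L : G → ℝ) (f : G → ℂ) (r : ℝ) (T : l2 G →L[ℂ] l2 G) : Prop :=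
  ∀ (ξ : l2 G) (x : G),
    T ξ x = if L x ≤ 2 * r then 0
      else ∑' y : G, (if L y ≤ r then f (x * y⁻¹) * ξ y else 0)

/-- The seminorm `J_D(f) = sup_{r>0} r ‖(I − M_{2r}) λ_f M_r‖`. -/
def JD (L : G → ℝ) (f : G → ℂ) : ℝ :=
  sSup {a : ℝ | ∃ r : ℝ, 0 < r ∧ ∃ T : l2 G →L[ℂ] l2 G, IsTruncOp L f r T ∧ a = r * ‖T‖}

/-- The convolution `h* ∗ k`, where `h*(z) = conj (h z⁻¹)`. -/
def starConv (h k : G → ℂ) : G → ℂ :=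
  fun x => ∑' z : G, conj (h z⁻¹) * k (z⁻¹ * x)

/-- The `ℓ²` norm `‖h‖₂ = (Σ_x |h x|²)^{1/2}` of a function `h : G → ℂ`. -/
def l2norm (h : G → ℂ) : ℝ := Real.sqrt (∑' x : G, ‖h x‖ ^ 2)

/-- The square of the `ℓ²` norm as an extended nonnegative sum. -/
lemma l2_enorm_sq {ι : Type*} (ξ : l2 ι) : ‖ξ‖ₑ ^ 2 = ∑' x, ‖ξ x‖ₑ ^ 2 := by
  have h := lp.hasSum_norm (p := 2) (by norm_num) ξ
  norm_num at h
  have h2 : HasSum (fun x => ‖ξ x‖₊ ^ 2) (‖ξ‖₊ ^ 2) := by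
    rw [← NNReal.hasSum_coe]
    simpa using h
  have h3 := ENNReal.hasSum_coe.mpr h2
  simpa [enorm] using h3.tsum_eq.symm

lemma memℓp_two_of_norm_le_comp {ι : Type*} (ξ : l2 ι) (σ : ι ≃ ι) {u : ι → ℂ}
    (hu : ∀ x, ‖u x‖ ≤ ‖ξ (σ x)‖) : Memℓp u 2 := by
  have h := (lp.memℓp ξ).summable (by norm_num)
  refine memℓp_gen (Summable.of_nonneg_of_le (fun _ => by positivity) (fun x => ?_)
    (h.comp_injective σ.injective))
  exact Real.rpow_le_rpow (norm_nonneg _) (hu x) (by norm_num)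

lemma l2_norm_le_of_norm_le_comp {ι : Type*} (σ : ι ≃ ι) {u v : l2 ι}
    (h : ∀ x, ‖u (σ x)‖ ≤ ‖v x‖) : ‖u‖ ≤ ‖v‖ := by
  have h2 : ‖u‖ₑ ^ 2 ≤ ‖v‖ₑ ^ 2 := by
    rw [l2_enorm_sq, l2_enorm_sq, ← σ.tsum_eq (fun x => ‖u x‖ₑ ^ 2)]
    refine ENNReal.tsum_le_tsum fun x => ?_
    gcongr
    exact enorm_le_iff_norm_le.mpr (h x)
  exact enorm_le_iff_norm_le.mp ((ENNReal.pow_le_pow_left_iff two_ne_zero).mp h2)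

open Classical in
/-- The restriction of `ξ ∈ ℓ²` to a set. -/
def l2restrict {ι : Type*} (A : Set ι) (ξ : l2 ι) : l2 ι :=
  ⟨fun y => if y ∈ A then ξ y else 0,
    memℓp_two_of_norm_le_comp ξ (Equiv.refl _) fun x => by
      by_cases h : x ∈ A <;> simp [h]⟩

open Classical in
lemma l2restrict_apply {ι : Type*} (A : Set ι) (ξ : l2 ι) (y : ι) :
    l2restrict A ξ y = if y ∈ A then ξ y else 0 := rfl

lemma sq_enorm_sum_le {ι : Type*} (F : Finset ι) (a : ι → ℂ) :
    ‖∑ b ∈ F, a b‖ₑ ^ 2 ≤ F.card * ∑ b ∈ F, ‖a b‖ₑ ^ 2 := by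
  have h : ‖∑ b ∈ F, a b‖₊ ^ 2 ≤ F.card * ∑ b ∈ F, ‖a b‖₊ ^ 2 :=
    (pow_le_pow_left₀ zero_le (nnnorm_sum_le F a) 2).trans sq_sum_le_card_mul_sum_sq
  simpa [enorm] using ENNReal.coe_le_coe.mpr h

/-- Averaging over right translates: an operator whose kernel `k` maps functions supported
in `Ez` to functions supported in `Fz`, with norm at most `c` on the former, has norm
at most `(|F| / |E|)^{1/2} c`. -/
lemma opNorm_le_of_translates (E F : Finset G) (hE : E.Nonempty) (S : l2 G →L[ℂ] l2 G)
    (k : G → G → ℂ) (hS : ∀ ξ x, S ξ x = ∑' y, k x y * ξ y)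
    (hk : ∀ x y z, k x y ≠ 0 → y * z⁻¹ ∈ E → x * z⁻¹ ∈ F) {c : ℝ} (hc : 0 ≤ c)
    (hloc : ∀ (z : G) (η : l2 G), (∀ y, y * z⁻¹ ∉ E → η y = 0) → ‖S η‖ ≤ c * ‖η‖) :
    ‖S‖ ≤ Real.sqrt ((F.card : ℝ) / E.card) * c := by
  classical
  obtain ⟨e, he⟩ := hE
  have hEpos : (0 : ℝ) < E.card := by exact_mod_cast Finset.card_pos.mpr ⟨e, he⟩
  have hfin : ∀ x, (Function.support (k x)).Finite := fun x => by
    refine (F.image fun b => e * b⁻¹ * x).finite_toSet.subset fun y hy => ?_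
    have := hk x y (e⁻¹ * y) hy (by simpa using he)
    simp only [Finset.coe_image, Set.mem_image]
    exact ⟨_, this, by group⟩
  set W : l2 G → G → l2 G := fun ξ z => l2restrict {y | y * z⁻¹ ∈ E} ξ with hW
  have hWa : ∀ ξ z y, W ξ z y = if y * z⁻¹ ∈ E then ξ y else 0 := fun ξ z y => by
    simp [hW, l2restrict_apply]
  have havg : ∀ ξ x, (E.card : ℂ) * S ξ x = ∑ b ∈ F, S (W ξ (b⁻¹ * x)) x := by
    intro ξ x
    simp only [hS, hWa]
    rw [← Summable.tsum_finsetSum, ← tsum_mul_left]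
    · refine tsum_congr fun y => ?_
      by_cases h : k x y = 0
      · simp [h]
      rw [← Finset.mul_sum, ← Finset.sum_filter, Finset.sum_const, nsmul_eq_mul]
      have hcard : (F.filter fun b => y * (b⁻¹ * x)⁻¹ ∈ E).card = E.card := by
        refine Finset.card_nbij' (fun b => y * (b⁻¹ * x)⁻¹) (fun a => x * y⁻¹ * a) ?_ ?_ ?_ ?_
        · intro b hb
          exact (Finset.mem_filter.mp hb).2
        · intro a ha
          have := hk x y (a⁻¹ * y) h (by simpa using ha)
          refine Finset.mem_coe.mpr (Finset.mem_filter.mpr ⟨?_, ?_⟩)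
          · simpa [mul_assoc] using this
          · simpa [mul_assoc] using ha
        · intro b _
          simp [mul_assoc]
        · intro a _
          simp [mul_assoc]
      rw [hcard]
      ring
    · intro b _
      refine summable_of_hasFiniteSupport ((hfin x).subset fun y hy => ?_)
      exact left_ne_zero_of_mul hy
  have hWsum : ∀ ξ, ∑' z, ‖W ξ z‖ₑ ^ 2 = E.card * ‖ξ‖ₑ ^ 2 := by
    intro ξ
    simp only [l2_enorm_sq]
    rw [ENNReal.tsum_comm, ← ENNReal.tsum_mul_left]
    refine tsum_congr fun y => ?_
    rw [← ((Equiv.inv G).trans (Equiv.mulRight y)).tsum_eq]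
    rw [tsum_eq_sum (s := E) fun z hz => by simp [hWa, hz]]
    rw [Finset.sum_congr rfl (g := fun _ => ‖ξ y‖ₑ ^ 2) fun z hz => by simp [hWa, hz]]
    simp
  refine S.opNorm_le_bound (by positivity) fun ξ => ?_
  have hmain : ((E.card : ℝ≥0∞) * ‖S ξ‖ₑ) ^ 2 ≤
      F.card * (ENNReal.ofReal c ^ 2 * (E.card * ‖ξ‖ₑ ^ 2)) := by
    calc ((E.card : ℝ≥0∞) * ‖S ξ‖ₑ) ^ 2 = ∑' x, ‖(E.card : ℂ) * S ξ x‖ₑ ^ 2 := by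
          rw [mul_pow, l2_enorm_sq, ← ENNReal.tsum_mul_left]
          refine tsum_congr fun x => ?_
          rw [enorm_mul, mul_pow]
          congr 2
          simp [enorm]
      _ ≤ ∑' x, F.card * ∑' z, ‖S (W ξ z) x‖ₑ ^ 2 := by
          refine ENNReal.tsum_le_tsum fun x => ?_
          rw [havg]
          refine (sq_enorm_sum_le _ _).trans ?_
          gcongr
          rw [← ((Equiv.inv G).trans (Equiv.mulRight x)).tsum_eq]
          exact ENNReal.sum_le_tsum (f := fun b => ‖S (W ξ (b⁻¹ * x)) x‖ₑ ^ 2) F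
      _ = F.card * ∑' z, ‖S (W ξ z)‖ₑ ^ 2 := by
          rw [ENNReal.tsum_mul_left, ENNReal.tsum_comm]
          simp only [l2_enorm_sq]
      _ ≤ F.card * ∑' z, ENNReal.ofReal c ^ 2 * ‖W ξ z‖ₑ ^ 2 := by
          gcongr with z
          rw [← mul_pow]
          gcongr
          rw [← ofReal_norm, ← ofReal_norm, ← ENNReal.ofReal_mul hc]
          exact ENNReal.ofReal_le_ofReal (hloc z _ fun y hy => by simp [hWa, hy])
      _ = _ := by rw [ENNReal.tsum_mul_left, hWsum]
  have hreal : ((E.card : ℝ) * ‖S ξ‖) ^ 2 ≤ F.card * (c ^ 2 * (E.card * ‖ξ‖ ^ 2)) := by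
    have h := ENNReal.toReal_mono (by finiteness) hmain
    simpa [hc] using h
  have hsq : ‖S ξ‖ ^ 2 ≤ (F.card : ℝ) / E.card * c ^ 2 * ‖ξ‖ ^ 2 := by
    rw [div_mul_eq_mul_div, div_mul_eq_mul_div, le_div_iff₀ hEpos]
    refine le_of_mul_le_mul_left ?_ hEpos
    linarith
  refine le_of_sq_le_sq ?_ (by positivity)
  rw [mul_pow, mul_pow, Real.sq_sqrt (by positivity)]
  exact hsq

lemma IsTruncOp.apply_eq {L : G → ℝ} {f : G → ℂ} {r : ℝ} {T : l2 G →L[ℂ] l2 G}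
    (hT : IsTruncOp L f r T) (ξ : l2 G) (x : G) :
    T ξ x = ∑' y, (if L x ≤ 2 * r then 0 else if L y ≤ r then f (x * y⁻¹) else 0) * ξ y := by
  rw [hT]
  split_ifs
  · simp
  · simp [ite_mul]

lemma IsTruncOp.unique {L : G → ℝ} {f : G → ℂ} {r : ℝ} {T T' : l2 G →L[ℂ] l2 G}
    (hT : IsTruncOp L f r T) (hT' : IsTruncOp L f r T') : T = T' := by
  ext ξ x
  rw [hT, hT']

/-- Truncated convolution operators exist when balls are finite. -/
lemma exists_isTruncOp_norm_le {L : G → ℝ} (hprop : IsProperLF L) (f : G →₀ ℂ) (r : ℝ) :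
    ∃ T : l2 G →L[ℂ] l2 G, IsTruncOp L f r T ∧
      ‖T‖ ≤ (lball L r).ncard * ∑ a ∈ f.support, ‖f a‖ := by
  classical
  set v : G → l2 G := fun y => ∑ a ∈ f.support,
    if L (a * y) ≤ 2 * r then 0 else lp.single 2 (a * y) (f a) with hv
  have hva : ∀ y x, v y x = if L x ≤ 2 * r then 0 else f (x * y⁻¹) := by
    intro y x
    have h1 : ∀ a, (if L (a * y) ≤ 2 * r then (0 : l2 G) else lp.single 2 (a * y) (f a)) x =
        if a = x * y⁻¹ then (if L x ≤ 2 * r then 0 else f a) else 0 := by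
      intro a
      by_cases h : a = x * y⁻¹
      · subst h
        by_cases h' : L x ≤ 2 * r <;> simp [h']
      · have h' : x ≠ a * y := fun h' => h (by simp [h'])
        split_ifs
        · rfl
        · simp [lp.single_apply, h']
    rw [hv]
    simp only [lp.coeFn_sum, Finset.sum_apply, h1]
    rw [Finset.sum_ite_eq']
    by_cases h : f (x * y⁻¹) = 0 <;> simp [h]
  have hvn : ∀ y, ‖v y‖ ≤ ∑ a ∈ f.support, ‖f a‖ := fun y => by
    refine norm_sum_le_of_le _ fun a _ => ?_
    split_ifs
    · simp
    · exact (lp.norm_single (by norm_num) _ _).le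
  refine ⟨∑ y ∈ (hprop r).toFinset, (lp.evalCLM ℂ (fun _ : G => ℂ) 2 y).smulRight (v y), ?_, ?_⟩
  · intro ξ x
    rw [tsum_eq_sum (s := (hprop r).toFinset) fun y hy => by
      rw [if_neg]; simpa [lball] using hy]
    simp only [_root_.sum_apply, lp.coeFn_sum, Finset.sum_apply,
      ContinuousLinearMap.smulRight_apply, lp.coeFn_smul, Pi.smul_apply, hva, smul_eq_mul]
    split_ifs
    · simp
    · refine Finset.sum_congr rfl fun y hy => ?_
      rw [if_pos (by simpa [lball] using hy), mul_comm]
      rfl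
  · rw [Set.ncard_eq_toFinset_card _ (hprop r), ← nsmul_eq_mul]
    refine (norm_sum_le_of_le _ fun y _ => ?_).trans (Finset.sum_const _).le
    rw [ContinuousLinearMap.norm_smulRight_apply]
    refine (mul_le_of_le_one_left (norm_nonneg _) ?_).trans (hvn y)
    refine ContinuousLinearMap.opNorm_le_bound _ zero_le_one fun ξ => ?_
    rw [one_mul]
    exact lp.norm_apply_le_norm (by norm_num) ξ y

lemma JD_nonneg (L : G → ℝ) (f : G → ℂ) : 0 ≤ JD L f := by
  refine Real.sSup_nonneg ?_
  rintro _ ⟨r, hr, T, -, rfl⟩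
  positivity

/-- The supremum defining `J_D(f)` is over a bounded set when `f` has finite support. -/
lemma IsTruncOp.mul_norm_le_JD {L : G → ℝ} (hL : IsLengthFunction L) (hprop : IsProperLF L)
    {f : G →₀ ℂ} {r : ℝ} (hr : 0 < r) {T : l2 G →L[ℂ] l2 G} (hT : IsTruncOp L f r T) :
    r * ‖T‖ ≤ JD L f := by
  refine le_csSup ?_ ⟨r, hr, T, hT, rfl⟩
  set R : ℝ := ∑ a ∈ f.support, L a with hR
  have hsupp : ∀ a, f a ≠ 0 → L a ≤ R := fun a ha =>
    Finset.single_le_sum (f := L) (fun b _ => hL.nonneg b) (Finsupp.mem_support_iff.mpr ha)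
  have hR0 : 0 ≤ R := Finset.sum_nonneg fun b _ => hL.nonneg b
  refine ⟨R * ((lball L R).ncard * ∑ a ∈ f.support, ‖f a‖), ?_⟩
  rintro _ ⟨q, hq, T, hT, rfl⟩
  rcases le_total q R with h | h
  · obtain ⟨T', hT', hn⟩ := exists_isTruncOp_norm_le hprop f q
    rw [hT.unique hT']
    have hcard : (lball L q).ncard ≤ (lball L R).ncard :=
      Set.ncard_le_ncard (fun x (hx : L x ≤ q) => hx.trans h) (hprop R)
    have : ‖T'‖ ≤ (lball L R).ncard * ∑ a ∈ f.support, ‖f a‖ := hn.trans (by gcongr)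
    gcongr
  · have : T = 0 := by
      ext ξ x
      rw [hT]
      split_ifs with hx
      · rfl
      · refine (tsum_congr fun y => ?_).trans tsum_zero
        split_ifs with hy
        · have : f (x * y⁻¹) = 0 := by
            by_contra hne
            have h1 := hsupp _ hne
            have h2 := hL.subadd (x * y⁻¹) y
            rw [inv_mul_cancel_right] at h2
            linarith
          simp [this]
        · rfl
    rw [this, norm_zero, mul_zero]
    positivity

/-- for `t > s > 3r > 0` and `f` vanishing on `A(s−2r, s)` and
`A(t, t+2r)`: `‖λ_{f·χ_{A(s,t)}}‖ ≤ r⁻¹ (|B(t+r)|/|B(r)|)^{1/2} J_D(f)` and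
`J_D(f·χ_{A(s,t)}) ≤ (|B(t+r)|/|B(r)|)^{1/2} J_D(f)`. -/
theorem norm_and_JD_annular_restriction_le
    (L : G → ℝ) (hL : IsLengthFunction L) (hprop : IsProperLF L)
    (r s t : ℝ) (hr : 0 < r) (hs : 3 * r < s) (hst : s < t)
    (f : G →₀ ℂ)
    (hf1 : ∀ x : G, s - 2 * r < L x → L x ≤ s → f x = 0)
    (hf2 : ∀ x : G, t < L x → L x ≤ t + 2 * r → f x = 0)
    (T : l2 G →L[ℂ] l2 G)
    (hT : IsConvOp (fun x => f x * (if s < L x ∧ L x ≤ t then (1 : ℂ) else 0)) T) :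
    ‖T‖ ≤ r⁻¹ * Real.sqrt (((lball L (t + r)).ncard : ℝ) / ((lball L r).ncard : ℝ)) *
        JD L (f : G → ℂ) ∧
    JD L (fun x => f x * (if s < L x ∧ L x ≤ t then (1 : ℂ) else 0)) ≤
      Real.sqrt (((lball L (t + r)).ncard : ℝ) / ((lball L r).ncard : ℝ)) *
        JD L (f : G → ℂ) := by
  classical
  set g : G → ℂ := fun x => f x * (if s < L x ∧ L x ≤ t then (1 : ℂ) else 0) with hg
  have hLdiv : ∀ x y, L (x * y⁻¹) ≤ L x + L y := fun x y => by
    simpa [hL.inv_eq] using hL.subadd x y⁻¹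
  have hLle : ∀ x y, L x ≤ L (x * y⁻¹) + L y := fun x y => by
    simpa using hL.subadd (x * y⁻¹) y
  have hg0 : ∀ x, g x ≠ 0 → s < L x ∧ L x ≤ t := fun x hx => by
    by_contra h
    exact hx (by simp [hg, h])
  have hgf : ∀ x, s - 2 * r < L x → L x ≤ t + 2 * r → f x = g x := fun x h1 h2 => by
    by_cases h : s < L x ∧ L x ≤ t
    · simp [hg, h]
    · rcases not_and_or.mp h with h' | h'
      · simp [hg, hf1 x h1 (not_lt.mp h')]
      · simp [hg, hf2 x (not_le.mp h') h2]
  have hg_out : ∀ x y, L y ≤ r → ¬(s - r < L x ∧ L x ≤ t + r) → g (x * y⁻¹) = 0 := by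
    intro x y hy hx
    by_contra hne
    obtain ⟨h1, h2⟩ := hg0 _ hne
    exact hx ⟨by linarith [hLdiv x y], by linarith [hLle x y]⟩
  have hg_in : ∀ x y, L y ≤ r → (s - r < L x ∧ L x ≤ t + r) → g (x * y⁻¹) = f (x * y⁻¹) :=
    fun x y hy hx => (hgf _ (by linarith [hLle x y]) (by linarith [hLdiv x y])).symm
  have hcancel : ∀ x y z : G, x * z⁻¹ * (y * z⁻¹)⁻¹ = x * y⁻¹ := fun x y z => by group
  set E := (hprop r).toFinset with hE
  set F := (hprop (t + r)).toFinset with hF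
  have hmE : ∀ x, x ∈ E ↔ L x ≤ r := fun x => by simp [hE, lball]
  have hmF : ∀ x, x ∈ F ↔ L x ≤ t + r := fun x => by simp [hF, lball]
  have hEne : E.Nonempty := ⟨1, (hmE 1).mpr (by rw [(hL.eq_zero_iff 1).mpr rfl]; exact hr.le)⟩
  have hgk : ∀ x y z, g (x * y⁻¹) ≠ 0 → y * z⁻¹ ∈ E → x * z⁻¹ ∈ F := by
    intro x y z hne hy
    rw [hmE] at hy
    by_contra hx
    rw [hmF] at hx
    refine hne ?_
    rw [← hcancel x y z]
    exact hg_out _ _ hy fun h => hx h.2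
  rw [Set.ncard_eq_toFinset_card _ (hprop r), Set.ncard_eq_toFinset_card _ (hprop (t + r))]
  constructor
  · obtain ⟨Q, hQ, -⟩ := exists_isTruncOp_norm_le hprop f r
    have hQJ : ‖Q‖ ≤ r⁻¹ * JD L f := by
      rw [inv_mul_eq_div, le_div_iff₀ hr, mul_comm]
      exact hQ.mul_norm_le_JD hL hprop hr
    rw [mul_right_comm, mul_comm]
    refine (opNorm_le_of_translates E F hEne T (fun x y => g (x * y⁻¹)) hT hgk (norm_nonneg Q)
      fun z η hη => ?_).trans (by gcongr)
    set η' : l2 G := ⟨fun y => η (y * z),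
      memℓp_two_of_norm_le_comp η (Equiv.mulRight z) fun y => le_rfl⟩ with hη'
    have hη'a : ∀ y, η' y = η (y * z) := fun y => rfl
    have hη'n : ‖η'‖ ≤ ‖η‖ :=
      l2_norm_le_of_norm_le_comp (Equiv.mulRight z⁻¹) fun x => by simp [hη'a]
    have hT' : ∀ x, T η (x * z) = ∑' y, g (x * y⁻¹) * η' y := fun x => by
      rw [hT, ← (Equiv.mulRight z).tsum_eq]
      refine tsum_congr fun y => ?_
      simp [hη'a, mul_assoc, hg]
    have hle : ‖T η‖ ≤ ‖Q η'‖ := by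
      refine l2_norm_le_of_norm_le_comp (Equiv.mulRight z) fun x => ?_
      rw [Equiv.coe_mulRight, hT']
      by_cases hx : s - r < L x ∧ L x ≤ t + r
      · refine le_of_eq (congrArg _ ?_)
        rw [hQ, if_neg (by linarith [hx.1])]
        refine tsum_congr fun y => ?_
        split_ifs with hy
        · rw [hg_in x y hy hx]
        · rw [hη'a, hη _ (by simpa [hmE] using hy), mul_zero]
      · rw [(tsum_congr fun y => ?_).trans tsum_zero, norm_zero]
        · exact norm_nonneg _
        · by_cases hy : L y ≤ r
          · rw [hg_out x y hy hx, zero_mul]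
          · rw [hη'a, hη _ (by simpa [hmE] using hy), mul_zero]
    exact hle.trans ((Q.le_opNorm η').trans (by gcongr))
  · refine Real.sSup_le ?_ (mul_nonneg (Real.sqrt_nonneg _) (JD_nonneg L f))
    rintro _ ⟨R, hR, S, hS, rfl⟩
    obtain ⟨Q, hQ, -⟩ := exists_isTruncOp_norm_le hprop f R
    have hQJ := hQ.mul_norm_le_JD hL hprop hR
    suffices h : ‖S‖ ≤ Real.sqrt ((F.card : ℝ) / E.card) * ‖Q‖ by
      calc R * ‖S‖ ≤ R * (Real.sqrt ((F.card : ℝ) / E.card) * ‖Q‖) := by gcongr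
        _ = Real.sqrt ((F.card : ℝ) / E.card) * (R * ‖Q‖) := by ring
        _ ≤ _ := by gcongr
    refine opNorm_le_of_translates E F hEne S _ hS.apply_eq (fun x y z hne => hgk x y z ?_)
      (norm_nonneg Q) fun z η hη => ?_
    · intro h
      simp [h] at hne
    have hle : ‖S η‖ ≤ ‖Q η‖ := by
      refine l2_norm_le_of_norm_le_comp (Equiv.refl G) fun x => ?_
      rw [Equiv.refl_apply, hS, hQ]
      by_cases hx2 : L x ≤ 2 * R
      · simp [hx2]
      rw [if_neg hx2, if_neg hx2]
      by_cases hx : s - r < L (x * z⁻¹) ∧ L (x * z⁻¹) ≤ t + r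
      · refine le_of_eq (congrArg _ (tsum_congr fun y => ?_))
        by_cases hy : L (y * z⁻¹) ≤ r
        · rw [← hcancel x y z, hg_in _ _ hy hx]
        · simp [hη y (by simpa [hmE] using hy)]
      · rw [(tsum_congr fun y => ?_).trans tsum_zero, norm_zero]
        · exact norm_nonneg _
        · by_cases hy : L (y * z⁻¹) ≤ r
          · rw [← hcancel x y z, hg_out _ _ hy hx, zero_mul, ite_self]
          · simp [hη y (by simpa [hmE] using hy)]
    exact hle.trans (Q.le_opNorm η)
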